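/- There is a bijection between closed integral frieze patterns of order n and triangulations of a convex n-gon, under which the quiddity sequence of a frieze equals the sequence (a_1, ..., a_n) where a_i is the number of triangles incident with vertex i. -/

import Mathlib

/-- A closed integral frieze pattern of order `n`, encoded as a function on pairs of
integer indices, supported on the band `i ≤ j ≤ i + n`, with bounding rows of 0s and 1s,
positive integer entries in the interior, and the unimodular diamond rule. -/
def IsClosedFrieze (n : ℕ) (a : ℤ → ℤ → ℤ) : Prop :=
  (∀ i : ℤ, a i i = 0) ∧
  (∀ i : ℤ, a i (i + 1) = 1) ∧
  (∀ i : ℤ, a i (i + n - 1) = 1) ∧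
  (∀ i : ℤ, a i (i + n) = 0) ∧
  (∀ i j : ℤ, i + 2 ≤ j → j ≤ i + n - 2 → 0 < a i j) ∧
  (∀ i j : ℤ, i + 1 ≤ j → j ≤ i + n - 1 →
    a i j * a (i + 1) (j + 1) - a i (j + 1) * a (i + 1) j = 1) ∧
  (∀ i j : ℤ, j < i → a i j = 0) ∧
  (∀ i j : ℤ, i + n < j → a i j = 0)
attribute [local instance] Classical.propDecidable

/-- A triangulation of a convex `n`-gon with vertices labelled by `ZMod n` (in cyclic order):
a maximal collection of pairwise non-crossing diagonals, i.e. `n - 3` of them. -/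
structure PolygonTriangulation (n : ℕ) [NeZero n] where
  diags : Finset (ZMod n × ZMod n)
  lt_of_mem : ∀ d ∈ diags, d.1.val < d.2.val
  not_boundary : ∀ d ∈ diags, d.1.val + 1 < d.2.val ∧ ¬(d.1.val = 0 ∧ d.2.val = n - 1)
  noncrossing : ∀ d ∈ diags, ∀ e ∈ diags,
    ¬(d.1.val < e.1.val ∧ e.1.val < d.2.val ∧ d.2.val < e.2.val)
  card_diags : diags.card = n - 3

/-- `i` and `j` are joined by an edge of the triangulation: a diagonal or a boundary edge. -/
def IsTriEdge {n : ℕ} [NeZero n] (T : PolygonTriangulation n) (i j : ZMod n) : Prop :=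
  (i, j) ∈ T.diags ∨ (j, i) ∈ T.diags ∨ j = i + 1 ∨ i = j + 1

/-- The triangles of a triangulation, as 3-element vertex sets all of whose sides are edges. -/
noncomputable def triangles {n : ℕ} [NeZero n] (T : PolygonTriangulation n) :
    Finset (Finset (ZMod n)) :=
  Finset.univ.filter (fun s => s.card = 3 ∧ ∀ i ∈ s, ∀ j ∈ s, i ≠ j → IsTriEdge T i j)

/-- The number of triangles of the triangulation incident with vertex `v`. -/
noncomputable def triCount {n : ℕ} [NeZero n] (T : PolygonTriangulation n) (v : ZMod n) : ℕ :=
  ((triangles T).filter (fun s => v ∈ s)).card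

namespace IsClosedFrieze

variable {n : ℕ} {a b : ℤ → ℤ → ℤ}

theorem pos (h : IsClosedFrieze n a) {i j : ℤ} (hij : i < j) (hj : j < i + n) : 0 < a i j := by
  obtain ⟨-, h1, h2, -, h3, -⟩ := h
  rcases eq_or_lt_of_le (Int.add_one_le_iff.2 hij) with rfl | h4
  · simp [h1]
  rcases eq_or_lt_of_le (Int.le_sub_one_of_lt hj) with rfl | h5
  · simp [h2]
  exact h3 i j (by lia) (by lia)

theorem nonneg (h : IsClosedFrieze n a) (i j : ℤ) : 0 ≤ a i j := by
  rcases lt_trichotomy i j with hij | rfl | hij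
  · rcases lt_trichotomy j (i + n) with hj | rfl | hj
    · exact (h.pos hij hj).le
    · exact (h.2.2.2.1 i).ge
    · exact (h.2.2.2.2.2.2.2 i j hj).ge
  · exact (h.1 i).ge
  · exact (h.2.2.2.2.2.2.1 i j hij).ge

theorem recurrence (h : IsClosedFrieze n a) {i j : ℤ} (hij : i < j) (hj : j < i + n) :
    a i (j - 1) + a i (j + 1) = a (j - 1) (j + 1) * a i j := by
  obtain ⟨d, hd⟩ : ∃ d : ℕ, j = i + 1 + d := ⟨(j - i - 1).toNat, by lia⟩
  induction d generalizing i with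
  | zero =>
    obtain rfl : j = i + 1 := by simpa using hd
    simp [h.1, h.2.1]
  | succ d ih =>
    have h1 := ih (i := i + 1) (by lia) (by lia) (by push_cast at hd; lia)
    have h2 := h.2.2.2.2.2.1 i (j - 1) (by lia) (by lia)
    have h3 := h.2.2.2.2.2.1 i j (by lia) (by lia)
    rw [sub_add_cancel] at h2
    have h4 : 0 < a (i + 1) j := h.pos (by lia) (by lia)
    apply mul_left_cancel₀ h4.ne'
    linear_combination h2 - h3 + a i j * h1

/-- The entries of a frieze are the determinants of pairs of columns of two consecutive rows. -/
theorem eq_det (h : IsClosedFrieze n a) {i j k : ℤ} (hij : i < j) (hjk : j ≤ k) (hk : k ≤ i + n) :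
    a i j * a (i + 1) k - a i k * a (i + 1) j = a j k := by
  obtain ⟨d, hd⟩ : ∃ d : ℕ, k = j + d := ⟨(k - j).toNat, by lia⟩
  induction d using Nat.strong_induction_on generalizing k with
  | _ d ih =>
    match d, hd with
    | 0, hd =>
      obtain rfl : k = j := by simpa using hd
      rw [h.1]; ring
    | 1, hd =>
      obtain rfl : k = j + 1 := by simpa using hd
      rw [h.2.1, h.2.2.2.2.2.1 i j (by lia) (by lia)]
    | d + 2, hd =>
      push_cast at hd
      have e1 := ih d (by lia) (k := k - 1 - 1) (by lia) (by lia) (by lia)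
      have e2 := ih (d + 1) (by lia) (k := k - 1) (by lia) (by lia) (by push_cast; lia)
      have r1 := h.recurrence (i := i) (j := k - 1) (by lia) (by lia)
      have r2 := h.recurrence (i := i + 1) (j := k - 1) (by lia) (by lia)
      have r3 := h.recurrence (i := j) (j := k - 1) (by lia) (by lia)
      rw [sub_add_cancel] at r1 r2 r3
      linear_combination a i j * r2 - a (i + 1) j * r1 - r3 - e1 + a (k - 1 - 1) k * e2

theorem glide (h : IsClosedFrieze n a) {i j : ℤ} (hij : i ≤ j) (hj : j ≤ i + n) :
    a j (i + n) = a i j := by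
  rcases eq_or_lt_of_le hij with rfl | hij
  · rw [h.1, h.2.2.2.1]
  · have h1 := h.eq_det hij hj le_rfl
    have h2 := h.2.2.1 (i + 1)
    rw [show i + 1 + (n : ℤ) - 1 = i + n by ring] at h2
    rw [← h1, h2, h.2.2.2.1]; ring

theorem periodic (h : IsClosedFrieze n a) (i j : ℤ) : a (i + n) (j + n) = a i j := by
  by_cases h1 : i ≤ j
  · by_cases h2 : j ≤ i + n
    · rw [h.glide (by lia) (by lia), h.glide h1 h2]
    · rw [h.2.2.2.2.2.2.2 i j (by lia), h.2.2.2.2.2.2.2 _ _ (by lia)]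
  · rw [h.2.2.2.2.2.2.1 i j (by lia), h.2.2.2.2.2.2.1 _ _ (by lia)]

theorem periodic_mul (h : IsClosedFrieze n a) (i j c : ℤ) :
    a (i + n * c) (j + n * c) = a i j := by
  induction c using Int.induction_on with
  | zero => simp
  | succ c ih => rw [← ih, ← h.periodic (i + n * c)]; congr 1 <;> ring
  | pred c ih => rw [← ih, ← h.periodic (i + n * (-c - 1))]; congr 1 <;> ring

theorem ptolemy (h : IsClosedFrieze n a) {w x y z : ℤ} (hwx : w ≤ x) (hxy : x ≤ y) (hyz : y ≤ z)
    (hz : z < w + n) : a w y * a x z = a w x * a y z + a w z * a x y := by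
  rw [← h.eq_det (i := w - 1) (j := w) (k := y) (by lia) (by lia) (by lia),
    ← h.eq_det (i := w - 1) (j := x) (k := z) (by lia) (by lia) (by lia),
    ← h.eq_det (i := w - 1) (j := w) (k := x) (by lia) (by lia) (by lia),
    ← h.eq_det (i := w - 1) (j := y) (k := z) (by lia) (by lia) (by lia),
    ← h.eq_det (i := w - 1) (j := w) (k := z) (by lia) (by lia) (by lia),
    ← h.eq_det (i := w - 1) (j := x) (k := y) (by lia) (by lia) (by lia)]
  ring

/-- Two diagonals on which a frieze takes the value `1` do not cross. -/
theorem not_crossing (h : IsClosedFrieze n a) {w x y z : ℤ} (hwx : w < x) (hxy : x < y)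
    (hyz : y < z) (hz : z < w + n) (h1 : a w y = 1) (h2 : a x z = 1) : False := by
  have h3 := h.ptolemy hwx.le hxy.le hyz.le hz
  have h4 := mul_pos (h.pos hwx (by lia)) (h.pos hyz (by lia))
  have h5 := mul_pos (h.pos (i := w) (j := z) (by lia) (by lia)) (h.pos hxy (by lia))
  rw [h1, h2] at h3
  lia

/-- An entry `1` of a frieze is the long side of a triangle all of whose sides carry `1`. -/
theorem exists_split (h : IsClosedFrieze n a) {i j : ℤ} (hij : i + 1 < j) (hj : j < i + n)
    (h1 : a i j = 1) : ∃ k, i < k ∧ k < j ∧ a i k = 1 ∧ a k j = 1 := by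
  obtain ⟨k, hik, hkj, hk, hk'⟩ :
      ∃ k, i ≤ k ∧ k < j ∧ a i k ≤ a k j ∧ a (k + 1) j < a i (k + 1) := by
    by_contra! hc
    have key : ∀ k, i ≤ k → k ≤ j → a i k ≤ a k j := by
      intro k hk
      induction k, hk using Int.leInduction with
      | base => intro; rw [h.1, h1]; exact zero_le_one
      | succ k hk ih => intro hkj; exact hc k hk (by lia) (ih (by lia))
    have := key j (by lia) le_rfl
    rw [h.1, h1] at this
    lia
  have p := h.ptolemy hik (show k ≤ k + 1 by lia) (show k + 1 ≤ j by lia) hj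
  rw [h1, h.2.1] at p
  have n1 := h.nonneg (k + 1) j
  have n2 := h.nonneg i k
  rcases eq_or_lt_of_le hk with hk | hk
  · have e : a i k * (a i (k + 1) - a (k + 1) j) = 1 := by rw [← hk] at p; linear_combination p
    have e1 : a i k = 1 := Int.eq_one_of_mul_eq_one_right n2 e
    refine ⟨k, ?_, hkj, e1, hk ▸ e1⟩
    rcases eq_or_lt_of_le hik with rfl | hik
    · rw [h.1] at e1; lia
    · exact hik
  · exfalso
    have e1 : 1 ≤ (a k j - a i k) * a i (k + 1) := by
      have : 0 < (a k j - a i k) * a i (k + 1) := mul_pos (by lia) (by lia)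
      lia
    have e2 : a i k = 0 := by
      by_contra hne
      have : 0 < a i k * (a i (k + 1) - a (k + 1) j) :=
        mul_pos (by lia) (by lia)
      nlinarith
    have e3 : k = i := by
      by_contra hne
      exact (h.pos (i := i) (j := k) (by lia) (by lia)).ne' e2
    subst e3
    rw [h.2.1] at hk'
    exact absurd (h.pos (i := k + 1) (j := j) (by lia) (by lia)) (by lia)

/-- On each diagonal with value `1`, a frieze is determined by its entries `1`. -/
theorem eqOn_of_one_iff (ha : IsClosedFrieze n a) (hb : IsClosedFrieze n b)
    {p q : ℤ} (hq : q < p + n)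
    (hab : ∀ k l, p ≤ k → k < l → l ≤ q → (a k l = 1 ↔ b k l = 1)) (d : ℕ) :
    ∀ i j, p ≤ i → j ≤ q → j = i + d → a i j = 1 →
      ∀ k l, i ≤ k → k ≤ l → l ≤ j → a k l = b k l := by
  induction d using Nat.strong_induction_on with
  | _ d ih =>
    intro i j hi hj hd h1 k l hik hkl hlj
    rcases eq_or_lt_of_le hkl with rfl | hkl
    · rw [ha.1, hb.1]
    rcases le_or_gt j (i + 1) with hij | hij
    · obtain rfl : k = i := by lia
      obtain rfl : l = k + 1 := by lia
      rw [ha.2.1, hb.2.1]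
    obtain ⟨m, him, hmj, h2, h3⟩ := ha.exists_split hij (by lia) h1
    have L := ih (m - i).toNat (by lia) i m hi (by lia) (by lia) h2
    have R := ih (j - m).toNat (by lia) m j (by lia) hj (by lia) h3
    have g1 := (hab i j hi (by lia) hj).1 h1
    have g2 := (hab i m hi him (by lia)).1 h2
    have g3 := (hab m j (by lia) hmj hj).1 h3
    rcases le_or_gt l m with hlm | hlm
    · exact L k l hik hkl.le hlm
    rcases le_or_gt m k with hmk | hmk
    · exact R k l hmk hkl.le hlj
    have pa := ha.ptolemy hik hmk.le hlm.le (by lia)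
    have pb := hb.ptolemy hik hmk.le hlm.le (by lia)
    have pa' := ha.ptolemy him.le hlm.le hlj (by lia)
    have pb' := hb.ptolemy him.le hlm.le hlj (by lia)
    rw [L i k le_rfl hik hmk.le, R m l le_rfl hlm.le hlj, L k m hik hmk.le le_rfl, h2] at pa
    rw [R l j hlm.le hlj le_rfl, R m l le_rfl hlm.le hlj, h1, h2, h3] at pa'
    rw [g2] at pb
    rw [g1, g2, g3] at pb'
    have e : a i l = b i l := by linear_combination pa' - pb'
    rw [e] at pa
    linear_combination pa - pb

theorem ext_of_one_iff (ha : IsClosedFrieze n a) (hb : IsClosedFrieze n b) (hn : 0 < n)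
    (hab : ∀ k l : ℤ, 0 ≤ k → k < l → l < n → (a k l = 1 ↔ b k l = 1)) : a = b := by
  have h1 : a 0 (n - 1) = 1 := by simpa using ha.2.2.1 0
  have key : ∀ k l : ℤ, 0 ≤ k → k ≤ l → l < n → a k l = b k l := fun k l hk hkl hl =>
    ha.eqOn_of_one_iff hb (p := 0) (q := n - 1) (by lia)
      (fun k l hk hkl hl => hab k l hk hkl (by lia)) (n - 1) 0 (n - 1) le_rfl le_rfl (by lia) h1
      k l hk hkl (by lia)
  funext i j
  by_cases hij : i ≤ j
  swap
  · rw [ha.2.2.2.2.2.2.1 i j (by lia), hb.2.2.2.2.2.2.1 i j (by lia)]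
  by_cases hj : j ≤ i + n
  swap
  · rw [ha.2.2.2.2.2.2.2 i j (by lia), hb.2.2.2.2.2.2.2 i j (by lia)]
  rw [← ha.periodic_mul i j (-(i / n)), ← hb.periodic_mul i j (-(i / n))]
  have e : i + n * -(i / n) = i % n := by rw [Int.emod_def]; ring
  have e1 := Int.emod_nonneg i (show (n : ℤ) ≠ 0 by lia)
  have e2 := Int.emod_lt_of_pos i (show (0 : ℤ) < n by lia)
  have e3 : i % n ≤ j + n * -(i / n) := by rw [← e]; lia
  have e4 : j + n * -(i / n) ≤ i % n + n := by rw [← e]; lia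
  rw [e]
  generalize j + n * -(i / n) = l at *
  generalize i % n = k at *
  rcases lt_or_ge l n with hl | hl
  · exact key k l e1 e3 hl
  · have e5 : l = (l - n) + n := by ring
    rw [e5, ha.glide (by lia) (by lia), hb.glide (by lia) (by lia)]
    exact key _ _ (by lia) (by lia) e2

theorem shift (h : IsClosedFrieze n a) (c : ℤ) :
    IsClosedFrieze n (fun i j => a (i + c) (j + c)) := by
  obtain ⟨h1, h2, h3, h4, h5, h6, h7, h8⟩ := h
  refine ⟨fun i => h1 _, fun i => ?_, fun i => ?_, fun i => ?_, fun i j h h' => ?_,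
    fun i j h h' => ?_, fun i j h => ?_, fun i j h => ?_⟩
  · simpa only [add_right_comm] using h2 (i + c)
  · simpa only [add_sub_right_comm, add_right_comm] using h3 (i + c)
  · simpa only [add_right_comm] using h4 (i + c)
  · exact h5 _ _ (by lia) (by lia)
  · simpa only [add_right_comm] using h6 (i + c) (j + c) (by lia) (by lia)
  · exact h7 _ _ (by lia)
  · exact h8 _ _ (by lia)

/-- Friezes may be translated by any integer. -/
def shiftEquiv (n : ℕ) (c : ℤ) :
    {a : ℤ → ℤ → ℤ // IsClosedFrieze n a} ≃ {a : ℤ → ℤ → ℤ // IsClosedFrieze n a} where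
  toFun a := ⟨_, a.2.shift c⟩
  invFun a := ⟨_, a.2.shift (-c)⟩
  left_inv a := by ext; simp
  right_inv a := by ext; simp

/-- The pairs of consecutive neighbours of `m` in the triangulation given by the ones of `a`. -/
noncomputable def linkPairs (n : ℕ) (a : ℤ → ℤ → ℤ) (m : ℤ) : Finset (ℤ × ℤ) :=
  ((Finset.Ioo m (m + n)) ×ˢ (Finset.Ioo m (m + n))).filter fun p =>
    p.1 < p.2 ∧ a m p.1 = 1 ∧ a m p.2 = 1 ∧ a p.1 p.2 = 1

theorem mem_linkPairs {m : ℤ} {p : ℤ × ℤ} : p ∈ linkPairs n a m ↔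
    m < p.1 ∧ p.1 < p.2 ∧ p.2 < m + n ∧ a m p.1 = 1 ∧ a m p.2 = 1 ∧ a p.1 p.2 = 1 := by
  simp only [linkPairs, Finset.mem_filter, Finset.mem_product, Finset.mem_Ioo]
  constructor
  · tauto
  · rintro ⟨h1, h2, h3, h4⟩
    exact ⟨⟨⟨h1, h2.trans h3⟩, h1.trans h2, h3⟩, h2, h4⟩

theorem card_linkPairs (h : IsClosedFrieze n a) (hn : 3 ≤ n) (m : ℤ) :
    ((linkPairs n a m).card : ℤ) = a (m - 1) (m + 1) := by
  have step : ∀ u w, m < u → u ≤ w → w < m + n → a m u = 1 → a m w = 1 →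
      a (m + 1) w = a u w + a (m + 1) u := by
    intro u w h1 h2 h3 h4 h5
    have := h.ptolemy (w := m) (x := m + 1) (y := u) (z := w) (by lia) (by lia) h2 h3
    rwa [h4, h5, h.2.1, one_mul, one_mul, one_mul] at this
  have hinj : ∀ u w, m < u → m < w → u < m + n → w < m + n → a m u = 1 → a m w = 1 →
      a (m + 1) u = a (m + 1) w → u = w := by
    intro u w h1 h2 h3 h4 h5 h6 h7
    rcases lt_trichotomy u w with hlt | heq | hlt
    · have := step u w h1 hlt.le h4 h5 h6
      have := h.pos hlt (by lia)
      lia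
    · exact heq
    · have := step w u h2 hlt.le h3 h6 h5
      have := h.pos hlt (by lia)
      lia
  have hlast : a m (m + n - 1) = 1 := h.2.2.1 m
  have hq : a (m + 1) (m + n - 1) = a (m - 1) (m + 1) := by
    rw [← h.glide (i := m - 1) (j := m + 1) (by lia) (by lia)]
    congr 1; ring
  have hnext : ∀ u, m < u → u < m + n - 1 → a m u = 1 → ∃ w, (u, w) ∈ linkPairs n a m := by
    intro u h1 h2 h3
    obtain ⟨w, h4, h5, h6, h7⟩ := h.exists_split (i := u) (j := m + n) (by lia) (by lia)
      (by rw [h.glide (by lia) (by lia), h3])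
    rw [h.glide (by lia) (by lia)] at h7
    exact ⟨w, mem_linkPairs.2 ⟨h1, h4, h5, h3, h7, h6⟩⟩
  have hsurj : ∀ t, 0 ≤ t → t ≤ a (m - 1) (m + 1) →
      ∃ u, m < u ∧ u < m + n ∧ a m u = 1 ∧ a (m + 1) u = t := by
    intro t ht
    induction t, ht using Int.leInduction with
    | base => intro; exact ⟨m + 1, by lia, by lia, h.2.1 m, h.1 _⟩
    | succ t ht ih =>
      intro htq
      obtain ⟨u, h1, h2, h3, h4⟩ := ih (by lia)
      have hne : u ≠ m + n - 1 := by
        rintro rfl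
        lia
      obtain ⟨w, hw⟩ := hnext u h1 (by lia) h3
      obtain ⟨-, h6, h7, -, h8, h9⟩ := mem_linkPairs.1 hw
      refine ⟨w, by lia, h7, h8, ?_⟩
      rw [step u w h1 h6.le h7 h3 h8, h9, h4, add_comm]
  have hcard : (linkPairs n a m).card = (Finset.Ico 0 (a (m - 1) (m + 1))).card := by
    refine Finset.card_bij (fun p _ => a (m + 1) p.1) ?_ ?_ ?_
    · intro p hp
      obtain ⟨h1, h2, h3, h4, h5, h6⟩ := mem_linkPairs.1 hp
      have s1 := step p.1 p.2 h1 h2.le h3 h4 h5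
      have s2 := step p.2 (m + n - 1) (by lia) (by lia) (by lia) h5 hlast
      have := h.nonneg p.2 (m + n - 1)
      rw [Finset.mem_Ico]
      exact ⟨h.nonneg _ _, by lia⟩
    · intro p hp p' hp' heq
      obtain ⟨h1, h2, h3, h4, h5, h6⟩ := mem_linkPairs.1 hp
      obtain ⟨h1', h2', h3', h4', h5', h6'⟩ := mem_linkPairs.1 hp'
      have s1 := step p.1 p.2 h1 h2.le h3 h4 h5
      have s2 := step p'.1 p'.2 h1' h2'.le h3' h4' h5'
      refine Prod.ext (hinj _ _ h1 h1' (by lia) (by lia) h4 h4' heq)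
        (hinj _ _ (by lia) (by lia) h3 h3' h5 h5' ?_)
      rw [s1, s2, h6, h6', heq]
    · intro t ht
      obtain ⟨ht0, htq⟩ := Finset.mem_Ico.1 ht
      obtain ⟨u, h1, h2, h3, h4⟩ := hsurj t ht0 htq.le
      have hne : u ≠ m + n - 1 := by
        rintro rfl
        lia
      obtain ⟨w, hw⟩ := hnext u h1 (by lia) h3
      exact ⟨(u, w), hw, h4⟩
  rw [hcard, Int.card_Ico, sub_zero, Int.toNat_of_nonneg (h.nonneg _ _)]

end IsClosedFrieze

/-- No two of the chords in `S` cross. -/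
def Noncrossing (S : Finset (ℕ × ℕ)) : Prop :=
  ∀ d ∈ S, ∀ e ∈ S, ¬(d.1 < e.1 ∧ e.1 < d.2 ∧ d.2 < e.2)

/-- `k < l` are consecutive, or joined by a chord in `S`. -/
def IsChordOrSide (S : Finset (ℕ × ℕ)) (k l : ℕ) : Prop := l = k + 1 ∨ (k, l) ∈ S

theorem Noncrossing.not_crossing {S : Finset (ℕ × ℕ)} (hc : Noncrossing S) {k l k' l' : ℕ}
    (h : IsChordOrSide S k l) (h' : IsChordOrSide S k' l') : ¬(k < k' ∧ k' < l ∧ l < l') := by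
  rcases h with h | h
  · lia
  rcases h' with h' | h'
  · lia
  exact hc _ h _ h'

theorem Noncrossing.card_le {S : Finset (ℕ × ℕ)} (hc : Noncrossing S) {N : ℕ}
    (hS : ∀ d ∈ S, d.1 + 1 < d.2 ∧ d.2 ≤ N) : S.card ≤ N - 1 := by
  have key : ∀ d ∈ S, ∃ m, d.1 < m ∧ m < d.2 ∧ IsChordOrSide S d.1 m ∧
      ∀ m', d.1 < m' → m' < d.2 → (d.1, m') ∈ S → m' ≤ m := by
    intro d hd
    obtain ⟨m, hm, hmax⟩ := Finset.exists_max_image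
      ((Finset.Ioo d.1 d.2).filter (IsChordOrSide S d.1)) id
      ⟨d.1 + 1, by simp [IsChordOrSide, (hS d hd).1]⟩
    simp only [Finset.mem_filter, Finset.mem_Ioo, id] at hm hmax
    exact ⟨m, hm.1.1, hm.1.2, hm.2, fun m' h1 h2 h3 => hmax m' ⟨⟨h1, h2⟩, Or.inr h3⟩⟩
  choose! f hf1 hf2 hf3 hf4 using key
  have hIoo : (Finset.Ioo 0 N).card = N - 1 := by simp
  rw [← hIoo]
  refine Finset.card_le_card_of_injOn f (fun d hd => ?_) ?_
  · have := hS d hd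
    have := hf1 d hd
    have := hf2 d hd
    simp only [Finset.coe_Ioo, Set.mem_Ioo]
    lia
  · have lt_false : ∀ d ∈ S, ∀ e ∈ S, f d = f e → ¬ d.1 < e.1 := by
      intro d hd e he h hlt
      have h1 := hf1 e he
      have h2 := hf2 e he
      exact hc.not_crossing (hf3 d hd) (Or.inr he : IsChordOrSide S e.1 e.2) ⟨hlt, by lia, by lia⟩
    have lt_false' : ∀ d ∈ S, ∀ e ∈ S, f d = f e → d.1 = e.1 → ¬ d.2 < e.2 := by
      intro d hd e he h h' hlt
      have h1 := hf2 d hd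
      have h3 := hS d hd
      have := hf4 e he d.2 (by lia) hlt (by rw [← h']; exact hd)
      lia
    intro d hd e he h
    have h1 : d.1 = e.1 := by
      have := lt_false d hd e he h
      have := lt_false e he d hd h.symm
      lia
    have := lt_false' d hd e he h h1
    have := lt_false' e he d hd h.symm h1.symm
    exact Prod.ext h1 (by lia)

/-- Every chord in `S` is the long side of a triangle made of chords and sides. -/
def HasSplits (S : Finset (ℕ × ℕ)) : Prop :=
  ∀ d ∈ S, ∃ m, d.1 < m ∧ m < d.2 ∧ IsChordOrSide S d.1 m ∧ IsChordOrSide S m d.2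

theorem HasSplits.le_card {S : Finset (ℕ × ℕ)} (hs : HasSplits S) (hc : Noncrossing S) {N : ℕ}
    (hN : (0, N) ∈ S) : N - 1 ≤ S.card := by
  have key : ∀ r k l, l ≤ k + r → (k, l) ∈ S → ∀ m, k < m → m < l →
      ∃ d ∈ S, d.1 < m ∧ m < d.2 ∧ IsChordOrSide S d.1 m ∧ IsChordOrSide S m d.2 := by
    intro r
    induction r with
    | zero => intro k l hl _ m; lia
    | succ r ih =>
      intro k l hl hkl m hkm hml
      obtain ⟨m', h1, h2, h3, h4⟩ := hs _ hkl
      simp only at h1 h2 h3 h4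
      rcases lt_trichotomy m m' with h | rfl | h
      · exact ih k m' (by lia) (h3.resolve_left (by lia)) m hkm h
      · exact ⟨_, hkl, h1, h2, h3, h4⟩
      · exact ih m' l (by lia) (h4.resolve_left (by lia)) m h hml
  replace key := fun m (hm : m ∈ Finset.Ioo 0 N) =>
    key N 0 N (by lia) hN m (Finset.mem_Ioo.1 hm).1 (Finset.mem_Ioo.1 hm).2
  choose! f hf1 hf2 hf3 hf4 hf5 using key
  have hIoo : (Finset.Ioo 0 N).card = N - 1 := by simp
  rw [← hIoo]
  refine Finset.card_le_card_of_injOn f hf1 ?_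
  have lt_false : ∀ m ∈ Finset.Ioo 0 N, ∀ m' ∈ Finset.Ioo 0 N, f m = f m' → ¬ m < m' := by
    intro m hm m' hm' h hlt
    have h1 := hf4 m' hm'
    rw [← h] at h1
    have h2 := hf3 m' hm'
    rw [← h] at h2
    exact hc.not_crossing h1 (hf5 m hm) ⟨hf2 m hm, hlt, h2⟩
  intro m hm m' hm' h
  have := lt_false m hm m' hm' h
  have := lt_false m' hm' m hm h.symm
  lia

theorem Noncrossing.hasSplits {S : Finset (ℕ × ℕ)} (hc : Noncrossing S) {N : ℕ}
    (hS : ∀ d ∈ S, d.1 + 1 < d.2 ∧ d.2 ≤ N) (hN : (0, N) ∈ S) (hcard : N - 1 ≤ S.card) :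
    HasSplits S := by
  rintro ⟨i, j⟩ hij
  obtain ⟨h1, h2⟩ := hS _ hij
  simp only at h1 h2 ⊢
  obtain ⟨m, hm, hmax⟩ := Finset.exists_max_image
    ((Finset.Ioo i j).filter (IsChordOrSide S i)) id
    ⟨i + 1, by simp [IsChordOrSide, h1]⟩
  simp only [Finset.mem_filter, Finset.mem_Ioo, id] at hm hmax
  obtain ⟨⟨him, hmj⟩, hm⟩ := hm
  refine ⟨m, him, hmj, hm, ?_⟩
  by_contra hno
  simp only [IsChordOrSide, not_or] at hno
  have noncross : Noncrossing (insert (m, j) S) := by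
    intro d hd e he
    rw [Finset.mem_insert] at hd he
    rcases hd with rfl | hd <;> rcases he with rfl | he
    · simp
    · have := hc _ hij _ he
      simp only at this ⊢
      lia
    · rintro ⟨g1, g2, g3⟩
      simp only at g1 g2 g3
      have c1 := hc _ hd _ hij
      have c2 := hc.not_crossing hm (Or.inr hd : IsChordOrSide S d.1 d.2)
      simp only at c1
      have e1 : d.1 = i := by lia
      have := hmax d.2 ⟨⟨by lia, g3⟩, by rw [← e1]; exact Or.inr hd⟩
      lia
    · exact hc _ hd _ he
  have := noncross.card_le (N := N) (by
    intro d hd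
    rcases Finset.mem_insert.1 hd with rfl | hd
    · exact ⟨by simp only; lia, h2⟩
    · exact hS d hd)
  rw [Finset.card_insert_of_notMem hno.2] at this
  have := (hS _ hN).1
  lia

/-- A triangulated polygon carries plane vectors, one for each vertex, all of whose determinants
are positive and whose determinants along the sides and chords are equal to `1`. -/
theorem HasSplits.exists_vectors {S : Finset (ℕ × ℕ)} (hs : HasSplits S) (hc : Noncrossing S)
    (r : ℕ) : ∀ i j, i < j → j ≤ i + r → IsChordOrSide S i j → ∃ x y : ℕ → ℤ,
      x i = 1 ∧ y i = 0 ∧ x j = 0 ∧ y j = 1 ∧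
      ∀ k l, i ≤ k → k < l → l ≤ j → 0 < x k * y l - x l * y k ∧
        (IsChordOrSide S k l → x k * y l - x l * y k = 1) := by
  induction r with
  | zero => intro i j; lia
  | succ r ih =>
    intro i j hij hr h
    by_cases hj : j = i + 1
    · subst hj
      refine ⟨fun k => if k = i then 1 else 0, fun k => if k = i then 0 else 1, by simp, by simp,
        by simp, by simp, fun k l hk hkl hl => ?_⟩
      obtain rfl : k = i := by lia
      obtain rfl : l = k + 1 := by lia
      simp
    obtain ⟨m, him, hmj, hm1, hm2⟩ := hs _ (h.resolve_left hj)
    simp only at him hmj hm1 hm2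
    obtain ⟨x, y, xi, yi, xm, ym, hL⟩ := ih i m him (by lia) hm1
    obtain ⟨z, w, zm, wm, zj, wj, hR⟩ := ih m j hmj (by lia) hm2
    refine ⟨fun k => if k ≤ m then x k + y k else z k,
      fun k => if k ≤ m then y k else z k + w k, ?_, ?_, ?_, ?_, fun k l hk hkl hl => ?_⟩
    · simp [him.le, xi, yi]
    · simp [him.le, yi]
    · simp [hmj.not_ge, zj]
    · simp [hmj.not_ge, zj, wj]
    simp only
    rcases le_or_gt l m with hlm | hlm
    · have hkm : k ≤ m := by lia
      obtain ⟨p1, p2⟩ := hL k l hk hkl hlm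
      simp only [hkm, hlm, if_true]
      exact ⟨by linear_combination p1, fun h => by linear_combination p2 h⟩
    rcases lt_trichotomy k m with hkm | rfl | hkm
    · rw [if_pos hkm.le, if_pos hkm.le, if_neg hlm.not_ge, if_neg hlm.not_ge]
      have xk : 0 < x k := by
        simpa [xm, ym] using (hL k m hk hkm le_rfl).1
      have yk : 0 ≤ y k := by
        rcases eq_or_lt_of_le hk with rfl | hk
        · exact yi.ge
        · simpa [xi, yi] using (hL i k le_rfl hk hkm.le).1.le
      have wl : 0 < w l := by
        simpa [zm, wm] using (hR m l le_rfl hlm hl).1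
      have zl : 0 ≤ z l := by
        rcases eq_or_lt_of_le hl with rfl | hl
        · exact zj.ge
        · simpa [zj, wj] using (hR l j hlm.le hl le_rfl).1.le
      refine ⟨by nlinarith [mul_pos xk wl, mul_nonneg yk wl.le, mul_nonneg xk.le zl],
        fun hE => ?_⟩
      obtain rfl : k = i := by
        have := hc.not_crossing hm1 hE
        lia
      obtain rfl : l = j := by
        have := hc.not_crossing hE hm2
        lia
      simp [xi, yi, zj, wj]
    · obtain ⟨p1, p2⟩ := hR k l le_rfl hkl hl
      rw [if_pos le_rfl, if_pos le_rfl, if_neg hlm.not_ge, if_neg hlm.not_ge, xm, ym]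
      rw [zm, wm] at p1 p2
      exact ⟨by linear_combination p1, fun h => by linear_combination p2 h⟩
    · obtain ⟨p1, p2⟩ := hR k l hkm.le hkl hl
      simp only [hkm.not_ge, hlm.not_ge, if_false]
      exact ⟨by linear_combination p1, fun h => by linear_combination p2 h⟩

theorem exists_antiperiodic {n : ℕ} (hn : 0 < n) (x : ℕ → ℤ) :
    ∃ X : ℤ → ℤ, (∀ k : ℕ, k < n → X k = x k) ∧ ∀ k, X (k + n) = -X k := by
  refine ⟨fun k => if Even (k / n) then x (k % n).toNat else -x (k % n).toNat, fun k hk => ?_,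
    fun k => ?_⟩
  · have h1 : (k : ℤ) / n = 0 := Int.ediv_eq_zero_of_lt (by lia) (by lia)
    have h2 : (k : ℤ) % n = k := Int.emod_eq_of_lt (by lia) (by lia)
    simp [h1, h2]
  · have h1 : (k + n) / (n : ℤ) = k / n + 1 := by
      rw [Int.add_ediv_of_dvd_right (dvd_refl _), Int.ediv_self (by lia)]
    simp only [h1, Int.add_emod_right, Int.even_add_one]
    split_ifs <;> simp_all

theorem exists_frieze_of_vectors {n : ℕ} (hn : 3 ≤ n) (x y : ℕ → ℤ)
    (hpos : ∀ k l, k < l → l < n → 0 < x k * y l - x l * y k)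
    (hone : ∀ k, k + 1 < n → x k * y (k + 1) - x (k + 1) * y k = 1)
    (hlast : x 0 * y (n - 1) - x (n - 1) * y 0 = 1) :
    ∃ a, IsClosedFrieze n a ∧
      ∀ k l : ℕ, k < l → l < n → a k l = x k * y l - x l * y k := by
  obtain ⟨X, hX, hX'⟩ := exists_antiperiodic (show 0 < n by lia) x
  obtain ⟨Y, hY, hY'⟩ := exists_antiperiodic (show 0 < n by lia) y
  set D : ℤ → ℤ → ℤ := fun i j => X i * Y j - X j * Y i with hD
  have swap : ∀ i j, D j (i + n) = D i j := fun i j => by simp only [hD, hX', hY']; ring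
  have per : ∀ i j c, D (i + n * c) (j + n * c) = D i j := by
    have per1 : ∀ i j, D (i + n) (j + n) = D i j := fun i j => by simp only [swap]
    intro i j c
    induction c using Int.induction_on with
    | zero => simp
    | succ c ih => rw [← ih, ← per1 (i + n * c)]; congr 1 <;> ring
    | pred c ih => rw [← ih, ← per1 (i + n * (-c - 1))]; congr 1 <;> ring
  have red : ∀ i j, ∃ k : ℕ, k < n ∧ D i j = D k (k + (j - i)) := by
    intro i j
    have e1 := Int.emod_nonneg i (show (n : ℤ) ≠ 0 by lia)
    have e2 := Int.emod_lt_of_pos i (show (0 : ℤ) < n by lia)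
    refine ⟨(i % n).toNat, by lia, ?_⟩
    rw [Int.toNat_of_nonneg e1, ← per i j (-(i / n))]
    congr 1 <;> rw [Int.emod_def] <;> ring
  have DN : ∀ k l : ℕ, k < n → l < n → D k l = x k * y l - x l * y k := fun k l hk hl => by
    simp only [hD, hX k hk, hY k hk, hX l hl, hY l hl]
  have Dpos : ∀ i j : ℤ, i < j → j < i + n → 0 < D i j := by
    intro i j hij hj
    obtain ⟨k, hk, e⟩ := red i j
    rw [e]
    obtain ⟨t, ht⟩ : ∃ t : ℕ, j - i = t := ⟨(j - i).toNat, by lia⟩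
    rw [ht]
    rcases lt_or_ge (k + t) n with h | h
    · have := hpos k (k + t) (by lia) h
      rw [← DN _ _ hk h] at this
      exact_mod_cast this
    · have := hpos (k + t - n) k (by lia) hk
      rw [← DN _ _ (by lia) hk, ← swap] at this
      rwa [show ((k + t - n : ℕ) : ℤ) + n = k + t by lia] at this
  have Done : ∀ i, D i (i + 1) = 1 := by
    intro i
    obtain ⟨k, hk, e⟩ := red i (i + 1)
    rw [e, add_sub_cancel_left]
    rcases Nat.lt_or_ge (k + 1) n with h | h
    · have := hone k h
      rw [← DN _ _ hk h] at this
      exact_mod_cast this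
    · obtain rfl : k = n - 1 := by lia
      rw [← DN _ _ (by lia) (by lia), ← swap] at hlast
      rwa [show ((n - 1 : ℕ) : ℤ) + 1 = (0 : ℕ) + n by lia]
  have D0 : ∀ i, D i i = 0 := fun i => by simp only [hD]; ring
  refine ⟨fun i j => if i ≤ j ∧ j ≤ i + n then D i j else 0, ⟨?_, ?_, ?_, ?_, ?_, ?_, ?_, ?_⟩, ?_⟩
  · intro i
    simp [D0]
  · intro i
    simp only
    rw [if_pos (by lia), Done]
  · intro i
    simp only
    rw [if_pos (by lia), show i + (n : ℤ) - 1 = (i - 1) + n by ring, swap]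
    simpa using Done (i - 1)
  · intro i
    simp only
    rw [if_pos (by lia), swap, D0]
  · intro i j h1 h2
    simp only
    rw [if_pos (by lia)]
    exact Dpos i j (by lia) (by lia)
  · intro i j h1 h2
    simp only
    rw [if_pos (by lia), if_pos (by lia), if_pos (by lia), if_pos (by lia)]
    have e1 := Done i
    have e2 := Done j
    simp only [hD] at e1 e2 ⊢
    linear_combination (X j * Y (j + 1) - X (j + 1) * Y j) * e1 + e2
  · intro i j h
    exact if_neg (by lia)
  · intro i j h
    exact if_neg (by lia)
  · intro k l h1 h2
    simp only
    rw [if_pos (by lia), DN k l (by lia) h2]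

/-- The chords of `{0, …, n - 1}` given by a set of diagonals and the side joining `0` to `n - 1`. -/
noncomputable def natChords {n : ℕ} (D : Finset (ZMod n × ZMod n)) : Finset (ℕ × ℕ) :=
  insert (0, n - 1) (D.image fun d => (d.1.val, d.2.val))

theorem exists_of_mem_natChords {n : ℕ} {D : Finset (ZMod n × ZMod n)} {p : ℕ × ℕ}
    (hp : p ∈ natChords D) : p = (0, n - 1) ∨ ∃ d ∈ D, (d.1.val, d.2.val) = p := by
  simpa only [natChords, Finset.mem_insert, Finset.mem_image] using hp

theorem card_natChords {n : ℕ} [NeZero n] {D : Finset (ZMod n × ZMod n)}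
    (hD : ∀ d ∈ D, ¬(d.1.val = 0 ∧ d.2.val = n - 1)) : (natChords D).card = D.card + 1 := by
  rw [natChords, Finset.card_insert_of_notMem, Finset.card_image_of_injective]
  · rintro ⟨x, y⟩ ⟨x', y'⟩ h
    simp only [Prod.mk.injEq] at h
    exact Prod.ext (ZMod.val_injective n h.1) (ZMod.val_injective n h.2)
  · rw [Finset.mem_image]
    rintro ⟨d, hd, h⟩
    exact hD d hd (by simpa using h)

theorem intCast_inj_of_mem_Ico {n : ℕ} {m u w : ℤ} (hu : m ≤ u) (hu' : u < m + n) (hw : m ≤ w)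
    (hw' : w < m + n) (h : (u : ZMod n) = w) : u = w := by
  rw [ZMod.intCast_eq_intCast_iff_dvd_sub] at h
  have := Int.eq_zero_of_abs_lt_dvd h (abs_lt.2 ⟨by lia, by lia⟩)
  lia

section Triangulation

variable {n : ℕ} [NeZero n]

theorem PolygonTriangulation.ext_diags {T T' : PolygonTriangulation n} (h : T.diags = T'.diags) :
    T = T' := by
  cases T; cases T'; congr

theorem mem_natChords {D : Finset (ZMod n × ZMod n)} {k l : ℕ} (hk : k < n) (hl : l < n) :
    (k, l) ∈ natChords D ↔ (k = 0 ∧ l = n - 1) ∨ ((k : ZMod n), (l : ZMod n)) ∈ D := by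
  simp only [natChords, Finset.mem_insert, Prod.mk.injEq, Finset.mem_image, Prod.exists]
  refine or_congr_right ⟨?_, fun h => ⟨_, _, h, ZMod.val_cast_of_lt hk, ZMod.val_cast_of_lt hl⟩⟩
  rintro ⟨x, y, h, rfl, rfl⟩
  simpa using h

/-- The diagonals of the `n`-gon on which `a` takes the value `1`. -/
noncomputable def oneDiags (n : ℕ) [NeZero n] (a : ℤ → ℤ → ℤ) : Finset (ZMod n × ZMod n) :=
  Finset.univ.filter fun d => d.1.val + 1 < d.2.val ∧ ¬(d.1.val = 0 ∧ d.2.val = n - 1) ∧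
    a d.1.val d.2.val = 1

theorem mem_oneDiags {a : ℤ → ℤ → ℤ} {d : ZMod n × ZMod n} :
    d ∈ oneDiags n a ↔ d.1.val + 1 < d.2.val ∧ ¬(d.1.val = 0 ∧ d.2.val = n - 1) ∧
      a d.1.val d.2.val = 1 := by
  simp [oneDiags]

theorem mem_oneDiags_natCast {a : ℤ → ℤ → ℤ} {k l : ℕ} (hk : k < n) (hl : l < n) :
    ((k : ZMod n), (l : ZMod n)) ∈ oneDiags n a ↔
      k + 1 < l ∧ ¬(k = 0 ∧ l = n - 1) ∧ a k l = 1 := by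
  rw [mem_oneDiags, ZMod.val_cast_of_lt hk, ZMod.val_cast_of_lt hl]

namespace IsClosedFrieze

variable {a : ℤ → ℤ → ℤ}

theorem zero_last (h : IsClosedFrieze n a) : a (0 : ℕ) (n - 1 : ℕ) = 1 := by
  have := h.2.2.1 0
  rwa [zero_add, show (n : ℤ) - 1 = (n - 1 : ℕ) by have := NeZero.pos n; lia] at this

theorem mem_natChords_oneDiags (h : IsClosedFrieze n a) (hn : 3 ≤ n) {p : ℕ × ℕ} :
    p ∈ natChords (oneDiags n a) ↔ p.1 + 1 < p.2 ∧ p.2 < n ∧ a p.1 p.2 = 1 := by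
  constructor
  · intro hp
    rcases exists_of_mem_natChords hp with rfl | ⟨d, hd, rfl⟩
    · exact ⟨by simp only; lia, by simp only; lia, h.zero_last⟩
    · rw [mem_oneDiags] at hd
      exact ⟨hd.1, ZMod.val_lt _, hd.2.2⟩
  · rintro ⟨h1, h2, h3⟩
    rw [← Prod.mk.eta (p := p), mem_natChords (by lia) h2, mem_oneDiags_natCast (by lia) h2]
    tauto

theorem isChordOrSide_iff (h : IsClosedFrieze n a) (hn : 3 ≤ n) {k l : ℕ} (hkl : k < l)
    (hl : l < n) : IsChordOrSide (natChords (oneDiags n a)) k l ↔ a k l = 1 := by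
  rw [IsChordOrSide, h.mem_natChords_oneDiags hn]
  constructor
  · rintro (rfl | h1)
    · exact_mod_cast h.2.1 k
    · exact h1.2.2
  · intro h1
    by_cases h2 : l = k + 1
    · exact Or.inl h2
    · exact Or.inr ⟨by simp only; lia, hl, h1⟩

theorem card_oneDiags (h : IsClosedFrieze n a) (hn : 3 ≤ n) : (oneDiags n a).card = n - 3 := by
  have hc : Noncrossing (natChords (oneDiags n a)) := by
    rintro d hd e he ⟨h1, h2, h3⟩
    rw [h.mem_natChords_oneDiags hn] at hd he
    exact h.not_crossing (w := d.1) (x := e.1) (y := d.2) (z := e.2) (by lia) (by lia) (by lia)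
      (by lia) hd.2.2 he.2.2
  have hs : HasSplits (natChords (oneDiags n a)) := by
    rintro ⟨k, l⟩ hd
    rw [h.mem_natChords_oneDiags hn] at hd
    obtain ⟨h1, h2, h3⟩ := hd
    simp only at h1 h2 h3
    obtain ⟨m, hm1, hm2, hm3, hm4⟩ := h.exists_split (by lia) (by lia) h3
    lift m to ℕ using by lia
    refine ⟨m, by simp only; lia, by simp only; lia, ?_, ?_⟩
    · exact (h.isChordOrSide_iff hn (by lia) (by lia)).2 hm3
    · exact (h.isChordOrSide_iff hn (by lia) (by lia)).2 hm4
  have h1 := hs.le_card hc (N := n - 1)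
    ((h.mem_natChords_oneDiags hn).2 ⟨by simp only; lia, by simp only; lia, h.zero_last⟩)
  have h2 := hc.card_le (N := n - 1) (fun d hd => by
    rw [h.mem_natChords_oneDiags hn] at hd
    exact ⟨hd.1, by lia⟩)
  rw [card_natChords (fun d hd => (mem_oneDiags.1 hd).2.1)] at h1 h2
  lia

/-- The triangulation whose diagonals are the entries `1` of a frieze. -/
noncomputable def toTriangulation (h : IsClosedFrieze n a) (hn : 3 ≤ n) :
    PolygonTriangulation n where
  diags := oneDiags n a
  lt_of_mem d hd := by
    have := (mem_oneDiags.1 hd).1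
    lia
  not_boundary d hd := ⟨(mem_oneDiags.1 hd).1, (mem_oneDiags.1 hd).2.1⟩
  noncrossing d hd e he := by
    rintro ⟨h1, h2, h3⟩
    have := ZMod.val_lt e.2
    exact h.not_crossing (w := d.1.val) (x := e.1.val) (y := d.2.val) (z := e.2.val) (by lia)
      (by lia) (by lia) (by lia) (mem_oneDiags.1 hd).2.2 (mem_oneDiags.1 he).2.2
  card_diags := h.card_oneDiags hn

theorem eq_of_toTriangulation_eq {b : ℤ → ℤ → ℤ} (ha : IsClosedFrieze n a)
    (hb : IsClosedFrieze n b) (hn : 3 ≤ n) (h : ha.toTriangulation hn = hb.toTriangulation hn) :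
    a = b := by
  refine ha.ext_of_one_iff hb (by lia) fun k l hk hkl hl => ?_
  lift k to ℕ using hk
  lift l to ℕ using by lia
  rw [← ha.isChordOrSide_iff hn (by lia) (by lia), ← hb.isChordOrSide_iff hn (by lia) (by lia),
    show oneDiags n a = oneDiags n b from congrArg PolygonTriangulation.diags h]

end IsClosedFrieze

theorem PolygonTriangulation.exists_frieze (T : PolygonTriangulation n) (hn : 3 ≤ n) :
    ∃ (a : ℤ → ℤ → ℤ) (h : IsClosedFrieze n a), h.toTriangulation hn = T := by
  have hcard := card_natChords fun d hd => (T.not_boundary d hd).2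
  rw [T.card_diags] at hcard
  have hS : ∀ d ∈ natChords T.diags, d.1 + 1 < d.2 ∧ d.2 ≤ n - 1 := by
    intro d hd
    rcases exists_of_mem_natChords hd with rfl | ⟨d, hd', rfl⟩
    · exact ⟨by simp only; lia, le_rfl⟩
    · have := ZMod.val_lt d.2
      exact ⟨(T.not_boundary d hd').1, by simp only; lia⟩
  have hc : Noncrossing (natChords T.diags) := by
    intro d hd e he
    rcases exists_of_mem_natChords hd with rfl | ⟨d, hd', rfl⟩
    · have := hS e he
      simp only
      lia
    rcases exists_of_mem_natChords he with rfl | ⟨e, he', rfl⟩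
    · simp
    exact T.noncrossing d hd' e he'
  have h0 : (0, n - 1) ∈ natChords T.diags := Finset.mem_insert_self _ _
  have hs := hc.hasSplits hS h0 (by lia)
  obtain ⟨x, y, -, -, -, -, hxy⟩ :=
    hs.exists_vectors hc (n - 1) 0 (n - 1) (by lia) (by lia) (Or.inr h0)
  obtain ⟨a, ha, hax⟩ := exists_frieze_of_vectors hn x y
    (fun k l hkl hl => (hxy k l (by lia) hkl (by lia)).1)
    (fun k hk => (hxy k (k + 1) (by lia) (by lia) (by lia)).2 (Or.inl rfl))
    ((hxy 0 (n - 1) le_rfl (by lia) le_rfl).2 (Or.inr h0))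
  refine ⟨a, ha, PolygonTriangulation.ext_diags (Finset.eq_of_subset_of_card_le (fun d hd => ?_)
    ?_).symm⟩
  · have hlt := T.lt_of_mem d hd
    have hl := ZMod.val_lt d.2
    obtain ⟨h1, h2⟩ := T.not_boundary d hd
    refine mem_oneDiags.2 ⟨h1, h2, ?_⟩
    rw [hax _ _ hlt hl]
    refine (hxy _ _ (by lia) hlt (by lia)).2 (Or.inr ?_)
    exact Finset.mem_insert_of_mem (Finset.mem_image_of_mem _ hd)
  · rw [T.card_diags, (ha.toTriangulation hn).card_diags]

theorem isTriEdge_comm {T : PolygonTriangulation n} {i j : ZMod n} :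
    IsTriEdge T i j ↔ IsTriEdge T j i := by
  unfold IsTriEdge
  tauto

theorem exists_intCast_eq (m : ℤ) (x : ZMod n) : ∃ u : ℤ, m ≤ u ∧ u < m + n ∧ (u : ZMod n) = x := by
  have hn : (0 : ℤ) < n := by exact_mod_cast NeZero.pos n
  refine ⟨m + (x.val - m) % n, ?_, ?_, by simp⟩
  · have := Int.emod_nonneg (x.val - m) hn.ne'
    lia
  · have := Int.emod_lt_of_pos (x.val - m) hn
    lia

namespace IsClosedFrieze

variable {a : ℤ → ℤ → ℤ}

theorem isTriEdge_natCast_iff (h : IsClosedFrieze n a) (hn : 3 ≤ n) {k l : ℕ} (hkl : k < l)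
    (hl : l < n) : IsTriEdge (h.toTriangulation hn) (k : ZMod n) (l : ZMod n) ↔ a k l = 1 := by
  have e1 : (l : ZMod n) = k + 1 ↔ l = k + 1 := by
    rw [← Nat.cast_succ, ZMod.natCast_eq_natCast_iff', Nat.mod_eq_of_lt hl,
      Nat.mod_eq_of_lt (by lia)]
  have e2 : (k : ZMod n) = l + 1 ↔ k = 0 ∧ l = n - 1 := by
    rw [← Nat.cast_succ, ZMod.natCast_eq_natCast_iff', Nat.mod_eq_of_lt (hkl.trans hl)]
    rcases eq_or_lt_of_le (Nat.succ_le_of_lt hl) with h1 | h1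
    · rw [h1, Nat.mod_self]
      lia
    · rw [Nat.mod_eq_of_lt h1]
      lia
  have e3 : ((l : ZMod n), (k : ZMod n)) ∉ oneDiags n a := by
    rw [mem_oneDiags_natCast hl (hkl.trans hl)]
    lia
  rw [IsTriEdge, e1, e2, ← h.isChordOrSide_iff hn hkl hl, IsChordOrSide,
    mem_natChords (hkl.trans hl) hl]
  change (_ ∈ oneDiags n a ∨ _ ∈ oneDiags n a ∨ _) ↔ _
  tauto

theorem isTriEdge_intCast_iff (h : IsClosedFrieze n a) (hn : 3 ≤ n) {u w : ℤ} (huw : u < w)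
    (hw : w < u + n) : IsTriEdge (h.toTriangulation hn) (u : ZMod n) (w : ZMod n) ↔ a u w = 1 := by
  have e1 := Int.emod_nonneg u (show (n : ℤ) ≠ 0 by lia)
  have e2 := Int.emod_lt_of_pos u (show (0 : ℤ) < n by lia)
  have e3 := Int.emod_add_mul_ediv u n
  generalize u / n = c at e3
  lift u % n to ℕ using e1 with k
  obtain ⟨l, hl⟩ : ∃ l : ℕ, w - n * c = l := ⟨(w - n * c).toNat, by lia⟩
  obtain rfl : u = k + n * c := by lia
  obtain rfl : w = l + n * c := by lia
  rw [h.periodic_mul]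
  push_cast
  simp only [ZMod.natCast_self, zero_mul, add_zero]
  rcases lt_or_ge l n with hln | hln
  · exact h.isTriEdge_natCast_iff hn (by lia) hln
  · obtain ⟨t, rfl⟩ : ∃ t : ℕ, l = t + n := ⟨l - n, by lia⟩
    push_cast
    rw [h.glide (by lia) (by lia), isTriEdge_comm, ZMod.natCast_self, add_zero]
    exact h.isTriEdge_natCast_iff hn (by lia) (by lia)

theorem triCount_toTriangulation (h : IsClosedFrieze n a) (hn : 3 ≤ n) (m : ℤ) :
    (triCount (h.toTriangulation hn) (m : ZMod n) : ℤ) = a (m - 1) (m + 1) := by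
  rw [← h.card_linkPairs hn m, Nat.cast_inj, triCount, eq_comm]
  have hinj : ∀ u w : ℤ, m ≤ u → u < m + n → m ≤ w → w < m + n → (u : ZMod n) = w → u = w :=
    fun u w h1 h2 h3 h4 => intCast_inj_of_mem_Ico h1 h2 h3 h4
  refine Finset.card_bij (fun p _ => {(m : ZMod n), (p.1 : ZMod n), (p.2 : ZMod n)}) ?_ ?_ ?_
  · intro p hp
    obtain ⟨h1, h2, h3, h4, h5, h6⟩ := mem_linkPairs.1 hp
    have n1 : (m : ZMod n) ≠ p.1 := fun e =>
      h1.ne (hinj _ _ (by lia) (by lia) (by lia) (by lia) e)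
    have n2 : (m : ZMod n) ≠ p.2 := fun e =>
      (h1.trans h2).ne (hinj _ _ (by lia) (by lia) (by lia) (by lia) e)
    have n3 : (p.1 : ZMod n) ≠ p.2 := fun e =>
      h2.ne (hinj _ _ (by lia) (by lia) (by lia) (by lia) e)
    have e1 := (h.isTriEdge_intCast_iff hn h1 (by lia)).2 h4
    have e2 := (h.isTriEdge_intCast_iff hn (h1.trans h2) h3).2 h5
    have e3 := (h.isTriEdge_intCast_iff hn h2 (by lia)).2 h6
    have e1' := isTriEdge_comm.1 e1
    have e2' := isTriEdge_comm.1 e2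
    have e3' := isTriEdge_comm.1 e3
    simp only [triangles, Finset.mem_filter, Finset.mem_univ, true_and]
    refine ⟨⟨Finset.card_eq_three.2 ⟨_, _, _, n1, n2, n3, rfl⟩, fun i hi j hj hij => ?_⟩,
      Finset.mem_insert_self _ _⟩
    simp only [Finset.mem_insert, Finset.mem_singleton] at hi hj
    rcases hi with rfl | rfl | rfl <;> rcases hj with rfl | rfl | rfl <;>
      first | assumption | exact absurd rfl hij
  · intro p hp p' hp' heq
    obtain ⟨h1, h2, h3, -⟩ := mem_linkPairs.1 hp
    obtain ⟨h1', h2', h3', -⟩ := mem_linkPairs.1 hp'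
    have k1 : (p.1 : ZMod n) ∈ ({(m : ZMod n), (p'.1 : ZMod n), (p'.2 : ZMod n)} : Finset _) := by
      rw [← heq]; simp
    have k2 : (p.2 : ZMod n) ∈ ({(m : ZMod n), (p'.1 : ZMod n), (p'.2 : ZMod n)} : Finset _) := by
      rw [← heq]; simp
    simp only [Finset.mem_insert, Finset.mem_singleton] at k1 k2
    have k1' : p.1 = m ∨ p.1 = p'.1 ∨ p.1 = p'.2 := by
      refine k1.imp ?_ (Or.imp ?_ ?_) <;> exact hinj _ _ (by lia) (by lia) (by lia) (by lia)
    have k2' : p.2 = m ∨ p.2 = p'.1 ∨ p.2 = p'.2 := by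
      refine k2.imp ?_ (Or.imp ?_ ?_) <;> exact hinj _ _ (by lia) (by lia) (by lia) (by lia)
    exact Prod.ext (by lia) (by lia)
  · intro s hs
    simp only [triangles, Finset.mem_filter, Finset.mem_univ, true_and] at hs
    obtain ⟨⟨hs3, hedge⟩, hm⟩ := hs
    obtain ⟨y, z, hyz, hs'⟩ := Finset.card_eq_two.1
      (show (s.erase (m : ZMod n)).card = 2 by rw [Finset.card_erase_of_mem hm, hs3])
    have hsm : s = {(m : ZMod n), y, z} := by rw [← hs', Finset.insert_erase hm]
    have hy : y ∈ s.erase (m : ZMod n) := by simp [hs']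
    have hz : z ∈ s.erase (m : ZMod n) := by simp [hs']
    obtain ⟨u, hu1, hu2, rfl⟩ := exists_intCast_eq m y
    obtain ⟨w, hw1, hw2, rfl⟩ := exists_intCast_eq m z
    rw [Finset.mem_erase] at hy hz
    have hu : m < u := lt_of_le_of_ne hu1 fun e => hy.1 (by rw [e])
    have hw : m < w := lt_of_le_of_ne hw1 fun e => hz.1 (by rw [e])
    have e1 := (h.isTriEdge_intCast_iff hn hu hu2).1 (hedge _ hm _ hy.2 (Ne.symm hy.1))
    have e2 := (h.isTriEdge_intCast_iff hn hw hw2).1 (hedge _ hm _ hz.2 (Ne.symm hz.1))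
    rcases lt_trichotomy u w with huw | rfl | huw
    · exact ⟨(u, w), mem_linkPairs.2 ⟨hu, huw, hw2, e1, e2,
        (h.isTriEdge_intCast_iff hn huw (by lia)).1 (hedge _ hy.2 _ hz.2 hyz)⟩, hsm.symm⟩
    · exact absurd rfl hyz
    · refine ⟨(w, u), mem_linkPairs.2 ⟨hw, huw, hu2, e2, e1,
        (h.isTriEdge_intCast_iff hn huw (by lia)).1 (hedge _ hz.2 _ hy.2 hyz.symm)⟩, ?_⟩
      rw [hsm, Finset.pair_comm]

end IsClosedFrieze

end Triangulation

/-- The Conway–Coxeter theorem: closed integral frieze patterns of order `n` are in bijection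
with triangulations of a convex `n`-gon, the quiddity sequence of the frieze being given by
the numbers of triangles incident with each vertex. -/
theorem conway_coxeter (n : ℕ) [NeZero n] (hn : 3 ≤ n) :
    ∃ e : PolygonTriangulation n ≃ {a : ℤ → ℤ → ℤ // IsClosedFrieze n a},
      ∀ (T : PolygonTriangulation n) (i : ℤ),
        (e T : ℤ → ℤ → ℤ) i (i + 2) = (triCount T (i : ZMod n) : ℤ) := by
  let F : {a : ℤ → ℤ → ℤ // IsClosedFrieze n a} → PolygonTriangulation n :=
    fun a => a.2.toTriangulation hn
  have hF : Function.Bijective F := by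
    refine ⟨fun a b hab => Subtype.ext (a.2.eq_of_toTriangulation_eq b.2 hn hab), fun T => ?_⟩
    obtain ⟨a, ha, rfl⟩ := T.exists_frieze hn
    exact ⟨⟨a, ha⟩, rfl⟩
  refine ⟨(Equiv.ofBijective F hF).symm.trans (IsClosedFrieze.shiftEquiv n (-1)), fun T i => ?_⟩
  obtain ⟨a, rfl⟩ := hF.2 T
  rw [a.2.triCount_toTriangulation hn i, Equiv.trans_apply,
    Equiv.ofBijective_symm_apply_apply]
  change a.1 (i + -1) (i + 2 + -1) = a.1 (i - 1) (i + 1)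
  rw [← sub_eq_add_neg, show i + 2 + -1 = i + 1 by ring]
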